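/- Let m_N, k_N be sequences of natural numbers with p_N := m_N·k_N → ∞ and p_N = o(N). For each N let A_N be Haar-distributed on O(N), let y_{i,j}^{(N)} = √N·(A_N)_{i,j} for 1 ≤ i ≤ m_N, 1 ≤ j ≤ k_N, and let ν_N = (1/p_N) ∑_{i=1}^{m_N} ∑_{j=1}^{k_N} δ_{y_{i,j}^{(N)}} be the random empirical measure. Then for every open set O in 𝒫(ℝ) (weak topology), liminf_{N→∞} (1/p_N)·log ℙ(ν_N ∈ O) ≥ −inf_{μ∈O} H(μ|γ), where γ is the standard Gaussian measure on ℝ and H(μ|γ) is the relative entropy of μ with respect to γ. -/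

import Mathlib

open MeasureTheory ProbabilityTheory Filter Matrix Asymptotics

noncomputable instance matrixMeasurableSpace {N : ℕ} :
    MeasurableSpace (Matrix (Fin N) (Fin N) ℝ) :=
  show MeasurableSpace (Fin N → Fin N → ℝ) from inferInstance

/-- The `(i,j)` entry of `A` (with `0`-based indices), or `0` if out of range. -/
def entryOrZero {N : ℕ} (A : Matrix (Fin N) (Fin N) ℝ) (i j : ℕ) : ℝ :=
  if h : i < N ∧ j < N then A ⟨i, h.1⟩ ⟨j, h.2⟩ else 0

/-- The empirical measure `(1/(m*k)) ∑_{i<m} ∑_{j<k} δ_{√N · A_{i,j}}`. -/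
noncomputable def empMeas (m k N : ℕ) (A : Matrix (Fin N) (Fin N) ℝ) : Measure ℝ :=
  ((m * k : ℕ) : ENNReal)⁻¹ •
    ∑ i ∈ Finset.range m, ∑ j ∈ Finset.range k,
      Measure.dirac (Real.sqrt N * entryOrZero A i j)

open scoped Classical in
/-- The empirical measure as a probability measure (junk value if `m*k = 0`). -/
noncomputable def empPM (m k N : ℕ) (A : Matrix (Fin N) (Fin N) ℝ) :
    ProbabilityMeasure ℝ :=
  if h : IsProbabilityMeasure (empMeas m k N A) then ⟨empMeas m k N A, h⟩
  else ⟨Measure.dirac 0, inferInstance⟩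

open scoped Classical in
/-- Relative entropy `H(μ|ν) = ∫ log (dμ/dν) dμ` if `μ ≪ ν` (and the integral exists),
`+∞` otherwise. -/
noncomputable def relEntropy (μ ν : Measure ℝ) : EReal :=
  if μ ≪ ν ∧ Integrable (llr μ ν) μ then ((∫ x, llr μ ν x ∂μ : ℝ) : EReal) else ⊤

theorem BoundedContinuousFunction.exists_abs_sub_le_sq (f : BoundedContinuousFunction ℝ ℝ)
    {ε : ℝ} (hε : 0 < ε) :
    ∃ C : ℝ, 0 ≤ C ∧ ∀ x y : ℝ, |f x - f y| ≤ ε + ε * x ^ 2 + C * (x - y) ^ 2 := by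
  have hb : ∀ x y, |f x - f y| ≤ 2 * ‖f‖ := fun x y => by
    simpa [Real.dist_eq] using f.dist_le_two_norm x y
  have hf0 : 0 ≤ ‖f‖ := norm_nonneg f
  obtain ⟨K, hK0, hK⟩ : ∃ K : ℝ, 0 < K ∧ 2 * ‖f‖ ≤ ε * K ^ 2 := by
    refine ⟨2 * ‖f‖ / ε + 1, by positivity, ?_⟩
    have h1 : 2 * ‖f‖ / ε * ε = 2 * ‖f‖ := by field_simp
    have h2 : 0 ≤ 2 * ‖f‖ / ε := by positivity
    nlinarith [mul_nonneg hε.le (sq_nonneg (2 * ‖f‖ / ε)), mul_nonneg hε.le h2]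
  have huc : UniformContinuousOn f (Set.Icc (-(K + 1)) (K + 1)) :=
    isCompact_Icc.uniformContinuousOn_of_continuous f.continuous.continuousOn
  obtain ⟨η, hη, hη'⟩ := Metric.uniformContinuousOn_iff.1 huc ε hε
  set η' := min η 1 with hη'def
  have hηp : 0 < η' := lt_min hη one_pos
  refine ⟨2 * ‖f‖ / η' ^ 2, by positivity, fun x y => ?_⟩
  have hC : 0 ≤ 2 * ‖f‖ / η' ^ 2 * (x - y) ^ 2 := by positivity
  have hx : 0 ≤ ε * x ^ 2 := by positivity
  by_cases h1 : K ≤ |x|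
  · have : K ^ 2 ≤ x ^ 2 := by rw [← sq_abs x]; gcongr
    have := mul_le_mul_of_nonneg_left this hε.le
    linarith [hb x y]
  push Not at h1
  by_cases h2 : |x - y| < η'
  · have hx' := abs_lt.1 h1
    have hy' := abs_lt.1 (h2.trans_le (min_le_right _ _))
    have := hη' x ⟨by linarith [hx'.1], by linarith [hx'.2]⟩ y
      ⟨by linarith [hx'.1, hy'.2], by linarith [hx'.2, hy'.1]⟩
      (by rw [Real.dist_eq]; exact h2.trans_le (min_le_left _ _))
    rw [Real.dist_eq] at this
    linarith
  · push Not at h2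
    have h3 : η' ^ 2 ≤ (x - y) ^ 2 := by rw [← sq_abs (x - y)]; gcongr
    have h4 : 2 * ‖f‖ ≤ 2 * ‖f‖ / η' ^ 2 * (x - y) ^ 2 := by
      rw [div_mul_eq_mul_div, le_div_iff₀ (by positivity)]
      gcongr
    linarith [hb x y]

theorem exists_finite_integral_basis_of_mem_nhds (ν : ProbabilityMeasure ℝ)
    {O : Set (ProbabilityMeasure ℝ)} (hO : O ∈ nhds ν) :
    ∃ (F : Finset (BoundedContinuousFunction ℝ ℝ)) (ε : ℝ), 0 < ε ∧
      ∀ μ : ProbabilityMeasure ℝ,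
        (∀ f ∈ F, |∫ x, f x ∂(μ : Measure ℝ) - ∫ x, f x ∂(ν : Measure ℝ)| < ε) → μ ∈ O := by
  have hle : (⨅ f : BoundedContinuousFunction ℝ ℝ,
      comap (fun μ : ProbabilityMeasure ℝ => ∫ x, f x ∂(μ : Measure ℝ))
        (nhds (∫ x, f x ∂(ν : Measure ℝ)))) ≤ nhds ν := by
    refine (ProbabilityMeasure.tendsto_iff_forall_integral_tendsto (μs := id)).2 fun f => ?_
    exact tendsto_comap.mono_left (iInf_le _ f)
  have hmem := hle hO
  rw [mem_iInf] at hmem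
  obtain ⟨I, hI, V, hV, rfl⟩ := hmem
  have : ∀ i : I, ∃ ε > 0, ∀ μ : ProbabilityMeasure ℝ,
      |∫ x, i.1 x ∂(μ : Measure ℝ) - ∫ x, i.1 x ∂(ν : Measure ℝ)| < ε → μ ∈ V i := by
    intro i
    obtain ⟨t, ht, htV⟩ := mem_comap.1 (hV i)
    obtain ⟨ε, hε, hb⟩ := Metric.mem_nhds_iff.1 ht
    exact ⟨ε, hε, fun μ hμ => htV (hb (by simpa [Real.dist_eq] using hμ))⟩
  choose ε hε h using this
  have : Finite I := hI
  have := Fintype.ofFinite I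
  obtain ⟨δ, hδ, hδ'⟩ : ∃ δ > 0, ∀ i, δ ≤ ε i := by
    rcases isEmpty_or_nonempty I with _ | _
    · exact ⟨1, one_pos, fun i => isEmptyElim i⟩
    · obtain ⟨i, hi⟩ := Finite.exists_min ε
      exact ⟨ε i, hε i, hi⟩
  refine ⟨hI.toFinset, δ, hδ, fun μ hμ => Set.mem_iInter.2 fun i => h i μ ?_⟩
  exact (hμ i.1 (by simp)).trans_le (hδ' i)

theorem MeasureTheory.Measure.pi_withDensity {ι : Type*} [Fintype ι] {X : ι → Type*}
    [∀ i, MeasurableSpace (X i)] (γ : ∀ i, Measure (X i)) [∀ i, IsProbabilityMeasure (γ i)]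
    {f : ∀ i, X i → ENNReal} (hf : ∀ i, Measurable (f i))
    [∀ i, SigmaFinite ((γ i).withDensity (f i))] :
    Measure.pi (fun i => (γ i).withDensity (f i)) =
      (Measure.pi γ).withDensity (fun x => ∏ i, f i (x i)) := by
  refine Measure.pi_eq fun s hs => ?_
  rw [withDensity_apply _ (MeasurableSet.univ_pi hs),
    ← lintegral_indicator (MeasurableSet.univ_pi hs)]
  have h1 : (Set.univ.pi s).indicator (fun x => ∏ i, f i (x i)) =
      fun x => ∏ i, (s i).indicator (f i) (x i) := by
    ext x
    by_cases hx : x ∈ Set.univ.pi s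
    · rw [Set.indicator_of_mem hx]
      exact Finset.prod_congr rfl fun i _ => (Set.indicator_of_mem (hx i trivial) _).symm
    · rw [Set.indicator_of_notMem hx]
      simp only [Set.mem_pi, Set.mem_univ, true_imp_iff, not_forall] at hx
      obtain ⟨i, hi⟩ := hx
      exact (Finset.prod_eq_zero (Finset.mem_univ i) (Set.indicator_of_notMem hi _)).symm
  have hind := iIndepFun_pi (μ := γ) (X := fun i => (s i).indicator (f i))
    fun i => ((hf i).indicator (hs i)).aemeasurable
  have hm : ∀ i, Measurable fun x : ∀ i, X i => (s i).indicator (f i) (x i) := fun i =>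
    ((hf i).indicator (hs i)).comp (measurable_pi_apply i)
  rw [h1]
  have := lintegral_prod_eq_prod_lintegral_of_indepFun Finset.univ
    (fun i (x : ∀ i, X i) => (s i).indicator (f i) (x i)) hind hm
  rw [this]
  refine Finset.prod_congr rfl fun i _ => ?_
  rw [withDensity_apply _ (hs i), ← lintegral_indicator (hs i)]
  exact (measurePreserving_eval γ i).lintegral_comp ((hf i).indicator (hs i))

theorem pi_le_exp_mul_of_sum_llr_le {ι : Type*} [Fintype ι]
    (κ γ : ι → Measure ℝ) [∀ i, IsProbabilityMeasure (κ i)] [∀ i, IsProbabilityMeasure (γ i)]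
    (hac : ∀ i, κ i ≪ γ i) {D : Set (ι → ℝ)} (hD : MeasurableSet D) {t : ℝ}
    (ht : ∀ᵐ x ∂(Measure.pi γ), x ∈ D → ∑ i, llr (κ i) (γ i) (x i) ≤ t) :
    Measure.pi κ D ≤ ENNReal.ofReal (Real.exp t) * Measure.pi γ D := by
  have hκ : ∀ i, (γ i).withDensity ((κ i).rnDeriv (γ i)) = κ i := fun i =>
    Measure.withDensity_rnDeriv_eq _ _ (hac i)
  have : ∀ i, SigmaFinite ((γ i).withDensity ((κ i).rnDeriv (γ i))) := fun i => by
    rw [hκ i]; infer_instance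
  have h := Measure.pi_withDensity γ (f := fun i => (κ i).rnDeriv (γ i))
    (fun i => Measure.measurable_rnDeriv _ _)
  simp_rw [hκ] at h
  rw [h, withDensity_apply _ hD, ← setLIntegral_const]
  have hfin : ∀ᵐ x ∂(Measure.pi γ), ∀ i, (κ i).rnDeriv (γ i) (x i) < ⊤ := by
    rw [ae_all_iff]
    intro i
    exact (measurePreserving_eval γ i).quasiMeasurePreserving.ae
      (Measure.rnDeriv_lt_top (κ i) (γ i))
  refine lintegral_mono_ae ?_
  filter_upwards [ae_restrict_of_ae hfin, ae_restrict_mem hD, ae_restrict_of_ae ht]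
    with x hx hxD hxt
  by_cases h0 : ∃ i, (κ i).rnDeriv (γ i) (x i) = 0
  · obtain ⟨i, hi⟩ := h0
    rw [Finset.prod_eq_zero (Finset.mem_univ i) hi]
    exact zero_le
  push Not at h0
  have h1 : ∀ i, (κ i).rnDeriv (γ i) (x i) = ENNReal.ofReal (Real.exp (llr (κ i) (γ i) (x i))) := by
    intro i
    rw [llr, Real.exp_log (ENNReal.toReal_pos (h0 i) (hx i).ne), ENNReal.ofReal_toReal (hx i).ne]
  simp_rw [h1]
  rw [← ENNReal.ofReal_prod_of_nonneg (fun i _ => (Real.exp_pos _).le), ← Real.exp_sum]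
  exact ENNReal.ofReal_le_ofReal (Real.exp_le_exp.2 (hxt hxD))

/-- A weak law of large numbers, uniform over all finite independent families. -/
theorem weak_law_of_integrable (ν : Measure ℝ) [IsProbabilityMeasure ν] {φ : ℝ → ℝ}
    (hφ : Integrable φ ν) {ε η : ℝ} (hε : 0 < ε) (hη : 0 < η) :
    ∃ p₀ : ℕ, 0 < p₀ ∧ ∀ {Ω : Type} [MeasurableSpace Ω] (ρ : Measure Ω) [IsProbabilityMeasure ρ]
      {ι : Type} (s : Finset ι) (X : ι → Ω → ℝ), iIndepFun X ρ → (∀ i, Measurable (X i)) →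
      (∀ i ∈ s, ρ.map (X i) = ν) → p₀ ≤ s.card →
      ρ.real {ω | ε * (s.card : ℝ) ≤ |∑ i ∈ s, φ (X i ω) - (s.card : ℝ) * ∫ x, φ x ∂ν|} ≤ η := by
  set δ := min (ε / 3) (ε * η / 6) with hδ
  have hδ0 : 0 < δ := lt_min (by positivity) (by positivity)
  obtain ⟨g, hg, hgL⟩ := (memLp_one_iff_integrable.2 hφ).exists_simpleFunc_eLpNorm_sub_lt
    (by simp) (ε := ENNReal.ofReal δ) (by simpa using hδ0)
  have hgi : Integrable g ν := memLp_one_iff_integrable.1 hgL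
  have hgint : ∫ x, |φ x - g x| ∂ν ≤ δ := by
    have h1 := (hφ.sub hgi)
    rw [eLpNorm_one_eq_lintegral_enorm] at hg
    have h2 := integral_norm_eq_lintegral_enorm h1.aestronglyMeasurable
    simp only [Pi.sub_apply, Real.norm_eq_abs] at h2
    rw [h2]
    exact ENNReal.toReal_le_of_le_ofReal hδ0.le hg.le
  have hg2 : MemLp g 2 ν := g.memLp_of_isFiniteMeasure 2 ν
  obtain ⟨p₀, hp₀⟩ := exists_nat_gt (18 * Var[g; ν] / (ε ^ 2 * η))
  refine ⟨p₀ + 1, by omega, fun {Ω} _ ρ _ {ι} s X hX hXm hXν hs => ?_⟩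
  set n : ℝ := (s.card : ℝ) with hn
  have hnp : (p₀ : ℝ) + 1 ≤ n := by rw [hn]; exact_mod_cast hs
  have hn0 : 0 < n := by
    have : (0 : ℝ) ≤ p₀ := Nat.cast_nonneg _
    linarith
  have hid : ∀ i ∈ s, ∀ h : ℝ → ℝ, AEStronglyMeasurable h ν →
      ∫ ω, h (X i ω) ∂ρ = ∫ x, h x ∂ν := fun i hi h hh => by
    rw [← hXν i hi, integral_map (hXm i).aemeasurable (by rwa [hXν i hi])]
  have hii : ∀ i ∈ s, ∀ h : ℝ → ℝ, Integrable h ν → Integrable (fun ω => h (X i ω)) ρ :=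
    fun i hi h hh => by
      rw [← hXν i hi] at hh
      exact hh.comp_measurable (hXm i)
  have hsub : {ω | ε * n ≤ |∑ i ∈ s, φ (X i ω) - n * ∫ x, φ x ∂ν|} ⊆
      {ω | ε * n / 3 ≤ ∑ i ∈ s, |φ (X i ω) - g (X i ω)|} ∪
      {ω | ε * n / 3 ≤ |(∑ i ∈ s, fun ω => g (X i ω)) ω - n * ∫ x, g x ∂ν|} := by
    intro ω hω
    by_contra hcon
    simp only [Set.mem_union, Set.mem_ofPred_eq, not_or, not_le, Finset.sum_apply] at hcon hω
    obtain ⟨ha, hb⟩ := hcon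
    have e1 : |∑ i ∈ s, φ (X i ω) - ∑ i ∈ s, g (X i ω)| ≤
        ∑ i ∈ s, |φ (X i ω) - g (X i ω)| := by
      rw [← Finset.sum_sub_distrib]; exact Finset.abs_sum_le_sum_abs _ _
    have e2 : |∫ x, φ x ∂ν - ∫ x, g x ∂ν| ≤ ε / 3 := by
      rw [← integral_sub hφ hgi]
      exact (abs_integral_le_integral_abs).trans (hgint.trans (min_le_left _ _))
    have e3 : |n * (∫ x, φ x ∂ν) - n * ∫ x, g x ∂ν| ≤ ε * n / 3 := by
      rw [← mul_sub, abs_mul, abs_of_pos hn0]; nlinarith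
    rw [abs_lt] at hb
    rw [abs_le] at e1 e3
    have : |∑ i ∈ s, φ (X i ω) - n * ∫ x, φ x ∂ν| < ε * n := by
      rw [abs_lt]; constructor <;> linarith
    linarith
  refine (measureReal_mono hsub).trans ((measureReal_union_le _ _).trans ?_)
  have hA : ρ.real {ω | ε * n / 3 ≤ ∑ i ∈ s, |φ (X i ω) - g (X i ω)|} ≤ η / 2 := by
    have h1 := mul_meas_ge_le_integral_of_nonneg (μ := ρ)
      (f := fun ω => ∑ i ∈ s, |φ (X i ω) - g (X i ω)|)
      (ae_of_all _ fun ω => Finset.sum_nonneg fun i _ => abs_nonneg _)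
      (integrable_finsetSum _ fun i hi => hii i hi (fun x => |φ x - g x|) (hφ.sub hgi).abs)
      (ε * n / 3)
    rw [integral_finsetSum _ fun i hi => hii i hi (fun x => |φ x - g x|) (hφ.sub hgi).abs,
      Finset.sum_congr rfl fun i hi => hid i hi (fun x => |φ x - g x|)
        (hφ.sub hgi).abs.aestronglyMeasurable, Finset.sum_const, nsmul_eq_mul] at h1
    have h2 : n * ∫ x, |φ x - g x| ∂ν ≤ n * (ε * η / 6) := by
      gcongr; exact hgint.trans (min_le_right _ _)
    have h3 : 0 < ε * n / 3 := by positivity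
    refine le_of_mul_le_mul_left ?_ h3
    calc _ ≤ _ := h1
      _ ≤ _ := h2
      _ = _ := by ring
  have hB : ρ.real {ω | ε * n / 3 ≤ |(∑ i ∈ s, fun ω => g (X i ω)) ω - n * ∫ x, g x ∂ν|}
      ≤ η / 2 := by
    have hL : ∀ i ∈ s, MemLp (fun ω => g (X i ω)) 2 ρ := fun i hi =>
      MemLp.comp_of_map (f := X i) (g := g) (by rw [hXν i hi]; exact hg2) (hXm i).aemeasurable
    have hV : Var[∑ i ∈ s, fun ω => g (X i ω); ρ] = n * Var[g; ν] := by
      rw [IndepFun.variance_sum hL]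
      · rw [Finset.sum_congr rfl fun i hi => show Var[fun ω => g (X i ω); ρ] = Var[g; ν] by
          rw [← hXν i hi, variance_map g.measurable.aemeasurable (hXm i).aemeasurable]; rfl]
        simp [hn]
      · intro i _ j _ hij
        exact (hX.indepFun hij).comp g.measurable g.measurable
    have hE : ∫ ω, (∑ i ∈ s, fun ω => g (X i ω)) ω ∂ρ = n * ∫ x, g x ∂ν := by
      simp only [Finset.sum_apply]
      rw [integral_finsetSum _ fun i hi => hii i hi g hgi,
        Finset.sum_congr rfl fun i hi => hid i hi g hgi.aestronglyMeasurable]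
      simp [hn]
    have h1 := meas_ge_le_variance_div_sq (μ := ρ) (memLp_finsetSum' s hL)
      (c := ε * n / 3) (by positivity)
    rw [hE, hV] at h1
    rw [measureReal_def]
    refine ENNReal.toReal_le_of_le_ofReal (by positivity) (h1.trans (ENNReal.ofReal_le_ofReal ?_))
    rw [div_le_iff₀ (by positivity)]
    have h3 : 18 * Var[g; ν] / (ε ^ 2 * η) < n := by linarith
    rw [div_lt_iff₀ (by positivity)] at h3
    nlinarith
  linarith

theorem integrable_sq_of_integrable_llr (ν : Measure ℝ) [IsProbabilityMeasure ν]
    (hac : ν ≪ gaussianReal 0 1) (hintg : Integrable (llr ν (gaussianReal 0 1)) ν) :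
    Integrable (fun x => x ^ 2) ν := by
  obtain ⟨C, hC, hexp⟩ := IsGaussian.exists_integrable_exp_sq (gaussianReal 0 1)
  set f : ℝ → ℝ := fun x => (ν.rnDeriv (gaussianReal 0 1) x).toReal with hf
  have hfm : Measurable f := (Measure.measurable_rnDeriv _ _).ennreal_toReal
  have h1 : Integrable (fun x => f x • llr ν (gaussianReal 0 1) x) (gaussianReal 0 1) :=
    (integrable_rnDeriv_smul_iff hac).2 hintg
  have h2 : Integrable (fun x => f x • (C * x ^ 2)) (gaussianReal 0 1) := by
    refine (h1.norm.add hexp).mono' (by fun_prop) (ae_of_all _ fun x => ?_)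
    have hfx : 0 ≤ f x := ENNReal.toReal_nonneg
    simp only [smul_eq_mul, Pi.add_apply, Real.norm_eq_abs, llr]
    rw [abs_of_nonneg (by positivity), sq_abs]
    change f x * (C * x ^ 2) ≤ |f x * Real.log (f x)| + _
    rcases hfx.eq_or_lt with h0 | h0
    · rw [← h0]; simp; positivity
    have h3 := Real.add_one_le_exp (C * x ^ 2 - Real.log (f x))
    rw [Real.exp_sub, Real.exp_log h0, le_div_iff₀ h0] at h3
    have := le_abs_self (f x * Real.log (f x))
    nlinarith
  have h3 := (integrable_rnDeriv_smul_iff hac).1 h2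
  simpa [← mul_assoc, hC.ne'] using h3.const_mul C⁻¹

theorem Matrix.exists_inv_sqrt_near_one {n : Type*} [Fintype n] [DecidableEq n]
    (W : Matrix n n ℝ) (hW : Wᵀ = W) {δ : ℝ} (hδ0 : 0 ≤ δ) (hδ : δ ≤ 1 / 2)
    (hWδ : ∑ i, ∑ j, (W - 1) i j ^ 2 ≤ δ ^ 2) :
    ∃ S : Matrix n n ℝ, S * W * Sᵀ = 1 ∧
      ∀ x : n → ℝ, ((S - 1) *ᵥ x) ⬝ᵥ ((S - 1) *ᵥ x) ≤ 4 * δ ^ 2 * (x ⬝ᵥ x) := by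
  have hH : W.IsHermitian := by rw [IsHermitian, conjTranspose_eq_transpose_of_trivial, hW]
  set d := hH.eigenvalues with hd
  obtain ⟨U, hU1, hU2, hWU⟩ : ∃ U : Matrix n n ℝ, U * Uᵀ = 1 ∧ Uᵀ * U = 1 ∧
      W = U * diagonal d * Uᵀ := by
    refine ⟨hH.eigenvectorUnitary, ?_, ?_, ?_⟩
    · have := Unitary.coe_mul_star_self hH.eigenvectorUnitary
      rwa [Unitary.coe_star, star_eq_conjTranspose, conjTranspose_eq_transpose_of_trivial] at this
    · have := Unitary.coe_star_mul_self hH.eigenvectorUnitary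
      rwa [star_eq_conjTranspose, conjTranspose_eq_transpose_of_trivial] at this
    · have := hH.spectral_theorem
      rw [Unitary.conjStarAlgAut_apply, star_eq_conjTranspose,
        conjTranspose_eq_transpose_of_trivial] at this
      exact this
  have hconj : ∀ a b : n → ℝ, (U * diagonal a * Uᵀ) * (U * diagonal b * Uᵀ) =
      U * diagonal (fun i => a i * b i) * Uᵀ := fun a b => by
    calc _ = U * diagonal a * (Uᵀ * U) * diagonal b * Uᵀ := by simp only [Matrix.mul_assoc]
      _ = _ := by rw [hU2, Matrix.mul_one, Matrix.mul_assoc U, diagonal_mul_diagonal]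
  have htr : ∀ a : n → ℝ, (U * diagonal a * Uᵀ)ᵀ = U * diagonal a * Uᵀ := fun a => by
    simp [Matrix.mul_assoc]
  have hsub : ∀ a : n → ℝ, U * diagonal a * Uᵀ - 1 = U * diagonal (fun i => a i - 1) * Uᵀ :=
    fun a => by
      have : diagonal (fun i => a i - 1) = diagonal a - (1 : Matrix n n ℝ) := by
        rw [← diagonal_one, diagonal_sub]
      rw [this, Matrix.mul_sub, Matrix.sub_mul, Matrix.mul_one, hU1]
  have hdδ : ∀ i, (d i - 1) ^ 2 ≤ δ ^ 2 := by
    intro i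
    have h1 : ∑ i, ∑ j, (W - 1) i j ^ 2 = ∑ i, (d i - 1) ^ 2 := by
      have : ∀ M : Matrix n n ℝ, ∑ i, ∑ j, M i j ^ 2 = trace (M * Mᵀ) := fun M => by
        simp [trace, Matrix.mul_apply, sq]
      rw [this, hWU, hsub, htr, hconj, trace_mul_comm, ← Matrix.mul_assoc, hU2, Matrix.one_mul,
        trace_diagonal]
      simp [sq]
    rw [h1] at hWδ
    exact (Finset.single_le_sum (f := fun i => (d i - 1) ^ 2) (fun i _ => sq_nonneg _)
      (Finset.mem_univ i)).trans hWδ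
  have hdabs : ∀ i, |d i - 1| ≤ δ := fun i => abs_le_of_sq_le_sq (hdδ i) hδ0
  have hdpos : ∀ i, 1 / 2 ≤ d i := fun i => by
    have := (abs_le.1 (hdabs i)).1
    linarith
  refine ⟨U * diagonal (fun i => (√(d i))⁻¹) * Uᵀ, ?_, fun x => ?_⟩
  · conv_lhs => rw [hWU]
    rw [htr, hconj, hconj]
    have : (fun i => (√(d i))⁻¹ * d i * (√(d i))⁻¹) = fun _ => (1 : ℝ) := by
      ext i
      have h0 : 0 < d i := by linarith [hdpos i]
      have h1 := Real.mul_self_sqrt h0.le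
      have h2 : 0 < √(d i) := Real.sqrt_pos.2 h0
      field_simp
      nlinarith
    rw [this, diagonal_one, Matrix.mul_one, hU1]
  · rw [hsub]
    set e : n → ℝ := fun i => (√(d i))⁻¹ - 1 with he
    have hee : ∀ i, e i * e i ≤ 4 * δ ^ 2 := by
      intro i
      have h0 : 0 < d i := by linarith [hdpos i]
      have h1 := Real.mul_self_sqrt h0.le
      have h2 : 0 < √(d i) := Real.sqrt_pos.2 h0
      have h3 : (e i * √(d i)) * (1 + √(d i)) = 1 - d i := by
        simp only [he]; field_simp; nlinarith
      have h4 : (1 : ℝ) / 2 ≤ √(d i) := Real.le_sqrt_of_sq_le (by linarith [hdpos i])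
      have h5 : (1 : ℝ) / 2 ≤ √(d i) * (1 + √(d i)) := by nlinarith
      have h6 : e i * (√(d i) * (1 + √(d i))) = 1 - d i := by rw [← h3]; ring
      have h7 : (1 - d i) ^ 2 ≤ δ ^ 2 := by
        have := hdδ i; nlinarith
      rw [← h6, mul_pow] at h7
      have h8 : (1 / 4 : ℝ) ≤ (√(d i) * (1 + √(d i))) ^ 2 := by nlinarith
      nlinarith [mul_le_mul_of_nonneg_left h8 (sq_nonneg (e i))]
    have hnorm : ∀ a : n → ℝ, ((U * diagonal a * Uᵀ) *ᵥ x) ⬝ᵥ ((U * diagonal a * Uᵀ) *ᵥ x) =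
        ∑ i, a i * a i * (Uᵀ *ᵥ x) i ^ 2 := fun a => by
      rw [dotProduct_mulVec, vecMul_mulVec, htr, hconj, ← dotProduct_mulVec,
        ← mulVec_mulVec, ← mulVec_mulVec, dotProduct_mulVec, ← mulVec_transpose]
      simp only [dotProduct, mulVec_diagonal]
      exact Finset.sum_congr rfl fun i _ => by ring
    have h1 : x ⬝ᵥ x = ∑ i, (Uᵀ *ᵥ x) i ^ 2 := by
      have := hnorm (fun _ => 1)
      rw [diagonal_one, Matrix.mul_one, hU1, one_mulVec] at this
      simpa using this
    rw [hnorm, h1, Finset.mul_sum]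
    exact Finset.sum_le_sum fun i _ => mul_le_mul_of_nonneg_right (hee i) (sq_nonneg _)

theorem Matrix.exists_orthogonal_extension {m N : ℕ} (hm : m ≤ N) (Q : Matrix (Fin m) (Fin N) ℝ)
    (hQ : Q * Qᵀ = 1) :
    ∃ B : Matrix (Fin N) (Fin N) ℝ, B * Bᵀ = 1 ∧
      ∀ (i : Fin m) (j : Fin N), B (Fin.castLE hm i) j = Q i j := by
  let v : Fin N → EuclideanSpace ℝ (Fin N) := fun i =>
    if h : (i : ℕ) < m then WithLp.toLp 2 (Q ⟨i, h⟩) else 0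
  have hv : ∀ i : Fin m, v (Fin.castLE hm i) = WithLp.toLp 2 (Q i) := fun i => by
    simp [v]
  have hon : Orthonormal ℝ ((Set.range (Fin.castLE hm)).domRestrict v) := by
    rw [orthonormal_iff_ite]
    rintro ⟨a, ha⟩ ⟨b, hb⟩
    obtain ⟨i, rfl⟩ := Set.mem_range.1 ha
    obtain ⟨j, rfl⟩ := Set.mem_range.1 hb
    have h := congrFun (congrFun hQ j) i
    simp only [Matrix.mul_apply, transpose_apply, Matrix.one_apply] at h
    simp only [Set.domRestrict_apply, hv, Subtype.mk.injEq, (Fin.castLE_injective hm).eq_iff]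
    rw [EuclideanSpace.inner_eq_star_dotProduct]
    simpa [dotProduct, eq_comm] using h
  obtain ⟨b, hb⟩ := hon.exists_orthonormalBasis_extension_of_card_eq (by simp)
  refine ⟨Matrix.of fun i j => b i j, ?_, fun i j => ?_⟩
  · ext i j
    have := orthonormal_iff_ite.1 b.orthonormal j i
    rw [EuclideanSpace.inner_eq_star_dotProduct] at this
    simp only [Matrix.mul_apply, transpose_apply, Matrix.one_apply, Matrix.of_apply]
    simpa [dotProduct, eq_comm] using this
  · change b (Fin.castLE hm i) j = Q i j
    rw [hb _ (Set.mem_range_self i), hv]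

theorem measurable_matrix_entry {N : ℕ} (i j : Fin N) :
    Measurable fun A : Matrix (Fin N) (Fin N) ℝ => A i j :=
  (measurable_pi_apply j).comp
    (measurable_pi_apply (X := fun _ : Fin N => Fin N → ℝ) i)

theorem measurable_matrix_of_entries {Ω : Type*} [MeasurableSpace Ω] {N : ℕ}
    {f : Ω → Matrix (Fin N) (Fin N) ℝ} (hf : ∀ i j, Measurable fun ω => f ω i j) :
    Measurable f :=
  measurable_pi_lambda (X := fun _ : Fin N => Fin N → ℝ) f
    fun i => measurable_pi_lambda _ fun j => hf i j

theorem measurable_matrix_mul {N : ℕ} :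
    Measurable fun p : Matrix (Fin N) (Fin N) ℝ × Matrix (Fin N) (Fin N) ℝ => p.1 * p.2 :=
  measurable_matrix_of_entries fun i j => by
    simp only [Matrix.mul_apply]
    exact Finset.measurable_sum _ fun l _ =>
      ((measurable_matrix_entry i l).comp measurable_fst).mul
        ((measurable_matrix_entry l j).comp measurable_snd)

theorem measurable_matrix_transpose {N : ℕ} :
    Measurable fun A : Matrix (Fin N) (Fin N) ℝ => Aᵀ :=
  measurable_matrix_of_entries fun i j => measurable_matrix_entry j i

theorem ae_mul_transpose_eq_one {N : ℕ} (μ : Measure (Matrix (Fin N) (Fin N) ℝ))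
    [IsProbabilityMeasure μ] (hsupp : μ {A | A * Aᵀ = 1} = 1) : ∀ᵐ A ∂μ, A * Aᵀ = 1 := by
  have hm : MeasurableSet {A : Matrix (Fin N) (Fin N) ℝ | A * Aᵀ = 1} := by
    have : {A : Matrix (Fin N) (Fin N) ℝ | A * Aᵀ = 1} =
        ⋂ i, ⋂ j, {A | (A * Aᵀ) i j = (1 : Matrix (Fin N) (Fin N) ℝ) i j} := by
      ext A
      simp only [Set.mem_iInter, Set.mem_ofPred_eq]
      exact ⟨fun h i j => by rw [h], fun h => Matrix.ext h⟩
    rw [this]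
    refine MeasurableSet.iInter fun i => MeasurableSet.iInter fun j => ?_
    have h1 : Measurable fun A : Matrix (Fin N) (Fin N) ℝ => (A * Aᵀ) i j :=
      (measurable_matrix_entry i j).comp
        (measurable_matrix_mul.comp (measurable_id.prodMk measurable_matrix_transpose))
    exact measurableSet_eq_fun h1 measurable_const
  exact (prob_compl_eq_zero_iff hm).2 hsupp

theorem measure_transpose_mem_eq {N : ℕ} (μ : Measure (Matrix (Fin N) (Fin N) ℝ))
    [IsProbabilityMeasure μ] (hsupp : μ {A | A * Aᵀ = 1} = 1)
    (hinv : ∀ B : Matrix (Fin N) (Fin N) ℝ, B * Bᵀ = 1 → μ.map (fun A => B * A) = μ) :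
    μ.map (fun A => Aᵀ) = μ := by
  ext s hs
  have hae := ae_mul_transpose_eq_one μ hsupp
  have hmul : ∀ B : Matrix (Fin N) (Fin N) ℝ, Measurable fun A => B * A := fun B =>
    measurable_matrix_mul.comp (measurable_const.prodMk measurable_id)
  rw [Measure.map_apply measurable_matrix_transpose hs]
  have hinvs : ∀ B : Matrix (Fin N) (Fin N) ℝ, B * Bᵀ = 1 → ∀ t, MeasurableSet t →
      μ ((fun A => B * A) ⁻¹' t) = μ t := fun B hB t ht => by
    rw [← Measure.map_apply (hmul B) ht, hinv B hB]
  have hT : MeasurableSet {p : Matrix (Fin N) (Fin N) ℝ × Matrix (Fin N) (Fin N) ℝ |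
      p.1ᵀ * p.2 ∈ s} :=
    (measurable_matrix_mul.comp
      ((measurable_matrix_transpose.comp measurable_fst).prodMk measurable_snd)) hs
  have h1 := Measure.prod_apply (μ := μ) (ν := μ) hT
  have h2 := Measure.prod_apply_symm (μ := μ) (ν := μ) hT
  rw [h1] at h2
  have h3 : ∫⁻ A, μ (Prod.mk A ⁻¹' {p : Matrix (Fin N) (Fin N) ℝ × Matrix (Fin N) (Fin N) ℝ |
      p.1ᵀ * p.2 ∈ s}) ∂μ = μ s := by
    rw [lintegral_congr_ae (g := fun _ => μ s), lintegral_const, measure_univ, mul_one]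
    filter_upwards [hae] with A hA
    exact hinvs Aᵀ (by rw [transpose_transpose]; exact mul_eq_one_comm.1 hA) s hs
  have h4 : ∫⁻ B, μ ((fun A => (A, B)) ⁻¹'
      {p : Matrix (Fin N) (Fin N) ℝ × Matrix (Fin N) (Fin N) ℝ | p.1ᵀ * p.2 ∈ s}) ∂μ =
      μ ((fun A => Aᵀ) ⁻¹' s) := by
    rw [lintegral_congr_ae (g := fun _ => μ ((fun A => Aᵀ) ⁻¹' s)), lintegral_const,
      measure_univ, mul_one]
    filter_upwards [hae] with B hB
    rw [← hinvs Bᵀ (by rw [transpose_transpose]; exact mul_eq_one_comm.1 hB) _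
      (measurable_matrix_transpose hs)]
    congr 1
    ext A
    simp
  rw [← h4, ← h2, h3]

theorem map_pi_gaussianReal_mul {m N : ℕ} (A : Matrix (Fin N) (Fin N) ℝ) (hA : A * Aᵀ = 1) :
    (Measure.pi fun _ : Fin m × Fin N => gaussianReal 0 1).map
      (fun (g : Fin m × Fin N → ℝ) (p : Fin m × Fin N) => ∑ l, g (p.1, l) * A l p.2) =
      Measure.pi fun _ => gaussianReal 0 1 := by
  have key : ∀ (C : Matrix (Fin N) (Fin N) ℝ) (x : EuclideanSpace ℝ (Fin m × Fin N))
      (i : Fin m) (j : Fin N), ∑ l, (∑ l', x (i, l') * C l' l) * Cᵀ l j =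
        ∑ l', x (i, l') * (C * Cᵀ) l' j := fun C x i j => by
    simp only [Matrix.mul_apply, Finset.sum_mul, Finset.mul_sum]
    rw [Finset.sum_comm]
    simp only [mul_assoc]
  have hone : ∀ (x : EuclideanSpace ℝ (Fin m × Fin N)) (i : Fin m) (j : Fin N),
      ∑ l', x (i, l') * (1 : Matrix (Fin N) (Fin N) ℝ) l' j = x (i, j) := fun x i j => by
    simp [Matrix.one_apply]
  let L : EuclideanSpace ℝ (Fin m × Fin N) ≃ₗ[ℝ] EuclideanSpace ℝ (Fin m × Fin N) :=
    { toFun := fun x => WithLp.toLp 2 fun p => ∑ l, x (p.1, l) * A l p.2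
      invFun := fun x => WithLp.toLp 2 fun p => ∑ l, x (p.1, l) * Aᵀ l p.2
      map_add' := fun x y => by ext p; simp [add_mul, Finset.sum_add_distrib]
      map_smul' := fun c x => by ext p; simp [Finset.mul_sum, mul_assoc]
      left_inv := fun x => by
        ext ⟨i, j⟩
        change ∑ l, (∑ l', x (i, l') * A l' l) * Aᵀ l j = x (i, j)
        rw [key, hA, hone]
      right_inv := fun x => by
        ext ⟨i, j⟩
        change ∑ l, (∑ l', x (i, l') * Aᵀ l' l) * Aᵀᵀ l j = x (i, j)
        rw [key, transpose_transpose, mul_eq_one_comm.1 hA, hone] }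
  have hL : ∀ x, ‖L x‖ = ‖x‖ := fun x => by
    rw [EuclideanSpace.norm_eq, EuclideanSpace.norm_eq]
    congr 1
    simp only [Real.norm_eq_abs, sq_abs, Fintype.sum_prod_type]
    refine Finset.sum_congr rfl fun i _ => ?_
    have h1 : ∀ j, L x (i, j) = ((fun l => x (i, l)) ᵥ* A) j := fun j => rfl
    calc ∑ j, L x (i, j) ^ 2 = ((fun l => x (i, l)) ᵥ* A) ⬝ᵥ ((fun l => x (i, l)) ᵥ* A) := by
          simp only [dotProduct, h1, sq]
      _ = ∑ j, x (i, j) ^ 2 := by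
          rw [← dotProduct_mulVec, ← mulVec_transpose, mulVec_mulVec, hA, one_mulVec]
          simp only [dotProduct, sq]
  let T : EuclideanSpace ℝ (Fin m × Fin N) ≃ₗᵢ[ℝ] EuclideanSpace ℝ (Fin m × Fin N) := ⟨L, hL⟩
  have h := stdGaussian_map T
  rw [← map_pi_eq_stdGaussian, Measure.map_map (by fun_prop) (by fun_prop)] at h
  have h2 := congrArg (Measure.map (WithLp.ofLp : EuclideanSpace ℝ (Fin m × Fin N) → _)) h
  rw [Measure.map_map (by fun_prop) (by fun_prop), Measure.map_map (by fun_prop) (by fun_prop)] at h2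
  have h3 : (WithLp.ofLp : EuclideanSpace ℝ (Fin m × Fin N) → _) ∘ WithLp.toLp 2 = id := rfl
  rw [h3, Measure.map_id] at h2
  exact h2

theorem pi_gaussianReal_le_of_forall_near {m N : ℕ} (hm : m ≤ N) (hN : 0 < N)
    (μ : Measure (Matrix (Fin N) (Fin N) ℝ))
    [IsProbabilityMeasure μ] (hsupp : μ {A | A * Aᵀ = 1} = 1)
    (hinv : ∀ B : Matrix (Fin N) (Fin N) ℝ, B * Bᵀ = 1 → μ.map (fun A => B * A) = μ)
    {δ : ℝ} (hδ0 : 0 ≤ δ) (hδ : δ ≤ 1 / 2)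
    {D : Set (Fin m × Fin N → ℝ)} (hD : MeasurableSet D)
    (hDδ : ∀ x ∈ D, ∑ i, ∑ i', ((∑ l, x (i, l) * x (i', l)) / N -
      (1 : Matrix (Fin m) (Fin m) ℝ) i i') ^ 2 ≤ δ ^ 2)
    {E : Set (Matrix (Fin N) (Fin N) ℝ)}
    (hE : ∀ x ∈ D, ∀ A : Matrix (Fin N) (Fin N) ℝ,
      (∀ j, ∑ i, (√N * A (Fin.castLE hm i) j - x (i, j)) ^ 2 ≤ 4 * δ ^ 2 * ∑ i, x (i, j) ^ 2) →
        A ∈ E) :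
    Measure.pi (fun _ => gaussianReal 0 1) D ≤ μ E := by
  have hae := ae_mul_transpose_eq_one μ hsupp
  have hmul : ∀ B : Matrix (Fin N) (Fin N) ℝ, Measurable fun A => B * A := fun B =>
    measurable_matrix_mul.comp (measurable_const.prodMk measurable_id)
  let act : (Fin m × Fin N → ℝ) → Matrix (Fin N) (Fin N) ℝ → (Fin m × Fin N → ℝ) :=
    fun g A p => ∑ l, g (p.1, l) * A l p.2
  have hact : Measurable fun p : (Fin m × Fin N → ℝ) × Matrix (Fin N) (Fin N) ℝ =>
      act p.1 p.2 := by
    refine measurable_pi_lambda _ fun q => Finset.measurable_sum _ fun l _ => ?_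
    exact ((measurable_pi_apply _).comp measurable_fst).mul
      ((measurable_matrix_entry _ _).comp measurable_snd)
  have hpoint : ∀ g, μ {A | act g A ∈ D} ≤ μ E := by
    intro g
    let G : Matrix (Fin m) (Fin N) ℝ := Matrix.of fun i l => g (i, l)
    have hGA : ∀ (A : Matrix (Fin N) (Fin N) ℝ) i j, act g A (i, j) = (G * A) i j :=
      fun A i j => rfl
    by_cases hex : ∃ A : Matrix (Fin N) (Fin N) ℝ, A * Aᵀ = 1 ∧ act g A ∈ D
    swap
    · have : μ {A | act g A ∈ D} = 0 := by
        rw [measure_eq_zero_iff_ae_notMem]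
        filter_upwards [hae] with A hA hAD
        exact hex ⟨A, hA, hAD⟩
      rw [this]; exact zero_le
    obtain ⟨A₀, hA₀, hA₀D⟩ := hex
    have hGram : (G * A₀) * (G * A₀)ᵀ = G * Gᵀ := by
      rw [transpose_mul, Matrix.mul_assoc, ← Matrix.mul_assoc A₀, hA₀, Matrix.one_mul]
    have hNR : (0 : ℝ) < N := by exact_mod_cast hN
    obtain ⟨S, hS1, hS2⟩ := Matrix.exists_inv_sqrt_near_one ((N : ℝ)⁻¹ • (G * Gᵀ))
      (by rw [transpose_smul, transpose_mul, transpose_transpose]) hδ0 hδ (by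
        rw [← hGram]
        refine le_trans (le_of_eq ?_) (hDδ _ hA₀D)
        refine Finset.sum_congr rfl fun i _ => Finset.sum_congr rfl fun i' _ => ?_
        simp only [hGA, Matrix.sub_apply, Matrix.smul_apply, smul_eq_mul]
        rw [Matrix.mul_apply, inv_mul_eq_div]
        rfl)
    have hsq : √(N : ℝ) * √N = N := Real.mul_self_sqrt hNR.le
    have hsq0 : 0 < √(N : ℝ) := Real.sqrt_pos.2 hNR
    obtain ⟨B, hB, hBQ⟩ := Matrix.exists_orthogonal_extension hm ((√(N : ℝ))⁻¹ • (S * G)) (by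
      rw [transpose_smul, Matrix.smul_mul, Matrix.mul_smul, smul_smul, ← mul_inv, hsq,
        transpose_mul, ← hS1]
      simp only [Matrix.mul_smul, Matrix.smul_mul, Matrix.mul_assoc])
    calc μ {A | act g A ∈ D} ≤ μ ((fun A => B * A) ⁻¹' E) := by
          refine measure_mono fun A hA => hE _ hA (B * A) fun j => ?_
          have h1 := hS2 fun i => act g A (i, j)
          simp only [dotProduct, ← sq] at h1
          refine le_trans (le_of_eq ?_) h1
          refine Finset.sum_congr rfl fun i _ => ?_
          congr 1
          have h2 : √(N : ℝ) * (B * A) (Fin.castLE hm i) j = (S * (G * A)) i j := by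
            rw [Matrix.mul_apply]
            simp only [hBQ]
            rw [← Matrix.mul_assoc, Matrix.mul_apply, Finset.mul_sum]
            refine Finset.sum_congr rfl fun l _ => ?_
            rw [Matrix.smul_apply, smul_eq_mul]
            field_simp
          rw [h2, Matrix.sub_mulVec, Matrix.one_mulVec]
          rfl
      _ ≤ μ.map (fun A => B * A) E := Measure.le_map_apply (hmul B).aemeasurable E
      _ = μ E := by rw [hinv B hB]
  set P : Measure (Fin m × Fin N → ℝ) := Measure.pi fun _ => gaussianReal 0 1 with hP
  have hmeas : MeasurableSet {p : (Fin m × Fin N → ℝ) × Matrix (Fin N) (Fin N) ℝ |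
      act p.1 p.2 ∈ D} := hact hD
  have h1 := Measure.prod_apply (μ := P) (ν := μ) hmeas
  have h2 := Measure.prod_apply_symm (μ := P) (ν := μ) hmeas
  have h3 : ∫⁻ A, P ((fun g => (g, A)) ⁻¹' {p : (Fin m × Fin N → ℝ) ×
      Matrix (Fin N) (Fin N) ℝ | act p.1 p.2 ∈ D}) ∂μ = P D := by
    rw [lintegral_congr_ae (g := fun _ => P D), lintegral_const, measure_univ, mul_one]
    filter_upwards [hae] with A hA
    have h4 := map_pi_gaussianReal_mul (m := m) A hA
    have h5 : Measurable fun g => act g A := hact.comp (measurable_id.prodMk measurable_const)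
    have h6 : P.map (fun g => act g A) D = P D := by rw [hP]; exact congrArg (· D) h4
    rw [Measure.map_apply h5 hD] at h6
    exact h6
  rw [← h3, ← h2, h1]
  calc _ ≤ ∫⁻ _, μ E ∂P := lintegral_mono fun g => hpoint g
    _ = μ E := by rw [lintegral_const, measure_univ, mul_one]

theorem Fin.sum_eq_sum_castLE_add {k N : ℕ} (hk : k ≤ N) (a : Fin N → ℝ) :
    ∑ j, a j = ∑ j : Fin k, a (Fin.castLE hk j) + ∑ j ∈ {l : Fin N | k ≤ (l : ℕ)}, a j := by
  rw [← Finset.sum_filter_add_sum_filter_not Finset.univ (fun j : Fin N => (j : ℕ) < k)]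
  congr 1
  · symm
    refine Finset.sum_bij (fun j _ => Fin.castLE hk j) (fun j _ => ?_) (fun _ _ _ _ h => ?_)
      (fun j hj => ?_) (fun _ _ => rfl)
    · simp
    · exact Fin.castLE_injective hk h
    · exact ⟨⟨j, by simpa using hj⟩, Finset.mem_univ _, rfl⟩
  · simp only [not_lt]

theorem integral_sq_gaussianReal : ∫ x, x ^ 2 ∂(gaussianReal 0 1) = 1 := by
  have h := variance_eq_sub (μ := gaussianReal 0 1) (memLp_id_gaussianReal 2)
  rw [variance_id_gaussianReal] at h
  simpa using h.symm

theorem integrable_pow_gaussianReal (n : ℕ) :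
    Integrable (fun x : ℝ => x ^ n) (gaussianReal 0 1) := by
  rcases Nat.eq_zero_or_pos n with rfl | hn
  · simp
  have h := (memLp_id_gaussianReal (μ := 0) (v := 1) (n : NNReal)).integrable_norm_pow
    (by omega)
  refine h.mono (by fun_prop) (ae_of_all _ fun x => ?_)
  simp

/-- If the last `N - k` columns of an independent array are standard Gaussian, then their
normalized Gram matrix is close to the identity in Frobenius norm with high probability. -/
theorem measureReal_gram_sub_one_le {m k N : ℕ} (hN : 0 < N) (hk : k ≤ N)
    (κ : Fin m × Fin N → Measure ℝ) [∀ p, IsProbabilityMeasure (κ p)]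
    (hκ : ∀ p, k ≤ (p.2 : ℕ) → κ p = gaussianReal 0 1) {t : ℝ} (ht : 0 < t) :
    (Measure.pi κ).real {x | t ≤ ∑ i, ∑ i',
        ((∑ l ∈ {l : Fin N | k ≤ (l : ℕ)}, x (i, l) * x (i', l)) / N -
          (1 : Matrix (Fin m) (Fin m) ℝ) i i') ^ 2} ≤
      ((∫ x, x ^ 4 ∂(gaussianReal 0 1)) * m ^ 2 / N + m * k ^ 2 / N ^ 2) / t := by
  set ρ := Measure.pi κ with hρ
  set M := ∫ x, x ^ 4 ∂(gaussianReal 0 1) with hM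
  have hNR : (0 : ℝ) < N := by exact_mod_cast hN
  have hind : iIndepFun (fun (p : Fin m × Fin N) (x : Fin m × Fin N → ℝ) => x p) ρ :=
    iIndepFun_pi (X := fun _ => id) fun _ => aemeasurable_id
  have hlaw : ∀ p, k ≤ (p.2 : ℕ) → MeasurePreserving (fun x : Fin m × Fin N → ℝ => x p) ρ
      (gaussianReal 0 1) := fun p hp => by
    rw [← hκ p hp]; exact measurePreserving_eval κ p
  have hcomp : ∀ p, k ≤ (p.2 : ℕ) → ∀ n : ℕ, ∫ x, x p ^ n ∂ρ = ∫ y, y ^ n ∂(gaussianReal 0 1) :=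
    fun p hp n => by
      rw [← (hlaw p hp).map_eq, integral_map (hlaw p hp).measurable.aemeasurable (by fun_prop)]
  have hintg : ∀ p, k ≤ (p.2 : ℕ) → ∀ n : ℕ, Integrable (fun x => x p ^ n) ρ := fun p hp n =>
    (hlaw p hp).integrable_comp_of_integrable (integrable_pow_gaussianReal n)
  have hmean : ∀ p, k ≤ (p.2 : ℕ) → ∫ x, x p ∂ρ = 0 := fun p hp => by
    simpa using hcomp p hp 1
  have hsq4 : ∀ a b : ℝ, (a * b) ^ 2 ≤ (a ^ 4 + b ^ 4) / 2 := fun a b => by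
    nlinarith [sq_nonneg (a ^ 2 - b ^ 2)]
  have hYL : ∀ (i i' : Fin m) (l : Fin N), k ≤ (l : ℕ) →
      MemLp (fun x => x (i, l) * x (i', l)) 2 ρ := by
    intro i i' l hl
    rw [memLp_two_iff_integrable_sq (by fun_prop)]
    refine (((hintg (i, l) hl 4).add (hintg (i', l) hl 4)).div_const 2).mono' (by fun_prop)
      (ae_of_all _ fun x => ?_)
    rw [Real.norm_of_nonneg (sq_nonneg _)]
    exact hsq4 _ _
  have hYV : ∀ (i i' : Fin m) (l : Fin N), k ≤ (l : ℕ) →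
      Var[fun x => x (i, l) * x (i', l); ρ] ≤ M := by
    intro i i' l hl
    refine (variance_le_expectation_sq (by fun_prop)).trans ?_
    calc ∫ x, ((fun x => x (i, l) * x (i', l)) ^ 2) x ∂ρ
        ≤ ∫ x, (x (i, l) ^ 4 + x (i', l) ^ 4) / 2 ∂ρ := by
          refine integral_mono (hYL i i' l hl).integrable_sq
            (((hintg (i, l) hl 4).add (hintg (i', l) hl 4)).div_const 2) fun x => hsq4 _ _
      _ = M := by
          rw [integral_div, integral_add (hintg (i, l) hl 4) (hintg (i', l) hl 4),
            hcomp (i, l) hl, hcomp (i', l) hl]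
          ring
  have hYE : ∀ (i i' : Fin m) (l : Fin N), k ≤ (l : ℕ) →
      ∫ x, x (i, l) * x (i', l) ∂ρ = (1 : Matrix (Fin m) (Fin m) ℝ) i i' := by
    intro i i' l hl
    by_cases h : i = i'
    · subst h
      simp_rw [← sq]
      rw [hcomp (i, l) hl, integral_sq_gaussianReal, Matrix.one_apply_eq]
    · have h1 : (i, l) ≠ (i', l) := fun h2 => h (Prod.ext_iff.1 h2).1
      have := (hind.indepFun h1).integral_fun_mul_eq_mul_integral
        (measurable_pi_apply _).aestronglyMeasurable (measurable_pi_apply _).aestronglyMeasurable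
      rw [Matrix.one_apply_ne h, this, hmean (i, l) hl, zero_mul]
  have hcard : ((Finset.univ.filter fun j : Fin N => k ≤ (j : ℕ)).card : ℝ) = N - k := by
    have := Fin.sum_eq_sum_castLE_add hk (fun _ => (1 : ℝ))
    simp only [Finset.sum_const, Finset.card_univ, Fintype.card_fin, nsmul_eq_mul, mul_one] at this
    linarith
  have hkR : (k : ℝ) ≤ N := by exact_mod_cast hk
  have hM0 : 0 ≤ M := integral_nonneg fun x => by positivity
  set Z : Fin m → Fin m → (Fin m × Fin N → ℝ) → ℝ := fun i i' x =>
    (∑ l ∈ {l : Fin N | k ≤ (l : ℕ)}, x (i, l) * x (i', l)) / N -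
      (1 : Matrix (Fin m) (Fin m) ℝ) i i' with hZ
  have hSL : ∀ i i', MemLp (∑ l ∈ {l : Fin N | k ≤ (l : ℕ)}, fun x : Fin m × Fin N → ℝ =>
      x (i, l) * x (i', l)) 2 ρ := fun i i' =>
    memLp_finsetSum' _ fun l hl => hYL i i' l (by simpa using hl)
  have hZeq : ∀ i i', Z i i' = fun x => (N : ℝ)⁻¹ * (∑ l ∈ {l : Fin N | k ≤ (l : ℕ)},
      fun x : Fin m × Fin N → ℝ => x (i, l) * x (i', l)) x -
        (1 : Matrix (Fin m) (Fin m) ℝ) i i' := fun i i' => by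
    ext x
    simp only [hZ, Finset.sum_apply]
    rw [inv_mul_eq_div]
  have hZL : ∀ i i', MemLp (Z i i') 2 ρ := fun i i' => by
    rw [hZeq]
    exact ((hSL i i').const_mul _).sub (memLp_const _)
  have hZ2 : ∀ i i', ∫ x, Z i i' x ^ 2 ∂ρ ≤
      M / N + (k : ℝ) ^ 2 / N ^ 2 * (1 : Matrix (Fin m) (Fin m) ℝ) i i' := by
    intro i i'
    have hV : Var[Z i i'; ρ] ≤ M / N := by
      rw [hZeq, variance_sub_const (((hSL i i').const_mul _).aestronglyMeasurable),
        variance_const_mul, IndepFun.variance_sum]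
      · have h1 : ∑ l ∈ {l : Fin N | k ≤ (l : ℕ)},
            Var[fun x => x (i, l) * x (i', l); ρ] ≤ N * M := by
          refine (Finset.sum_le_card_nsmul _ _ M fun l hl =>
            hYV i i' l (by simpa using hl)).trans ?_
          rw [nsmul_eq_mul, hcard]
          have : (0 : ℝ) ≤ k := Nat.cast_nonneg _
          gcongr
          linarith
        calc _ ≤ (N : ℝ)⁻¹ ^ 2 * (N * M) := by gcongr
          _ = M / N := by field_simp
      · exact fun l hl => hYL i i' l (by simpa using hl)
      · intro l _ l' _ hll
        have h1 : ∀ a b : Fin m, (a, l) ≠ (b, l') := fun a b h2 => hll (Prod.ext_iff.1 h2).2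
        exact hind.indepFun_mul_mul (fun p => measurable_pi_apply p) _ _ _ _
          (h1 _ _) (h1 _ _) (h1 _ _) (h1 _ _)
    have hE : ∫ x, Z i i' x ∂ρ = -(k / N) * (1 : Matrix (Fin m) (Fin m) ℝ) i i' := by
      rw [hZeq, integral_sub (((hSL i i').integrable one_le_two).const_mul _)
        (integrable_const _), integral_const_mul]
      simp only [Finset.sum_apply]
      rw [integral_finsetSum _ fun l hl =>
          (hYL i i' l (by simpa using hl)).integrable one_le_two,
        Finset.sum_congr rfl fun l hl => hYE i i' l (by simpa using hl), Finset.sum_const,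
        nsmul_eq_mul, hcard]
      simp only [integral_const, probReal_univ, one_smul]
      field_simp
      ring
    have h1 := variance_eq_sub (hZL i i')
    rw [hE] at h1
    have h2 : (-(k / N) * (1 : Matrix (Fin m) (Fin m) ℝ) i i') ^ 2 =
        (k : ℝ) ^ 2 / N ^ 2 * (1 : Matrix (Fin m) (Fin m) ℝ) i i' := by
      by_cases h : i = i'
      · subst h; rw [Matrix.one_apply_eq]; field_simp
      · rw [Matrix.one_apply_ne h]; ring
    rw [h2] at h1
    simp only [Pi.pow_apply] at h1
    linarith
  have hZint : ∀ i i', Integrable (fun x => Z i i' x ^ 2) ρ := fun i i' => (hZL i i').integrable_sq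
  have hmark := mul_meas_ge_le_integral_of_nonneg (μ := ρ)
    (f := fun x => ∑ i, ∑ i', Z i i' x ^ 2)
    (ae_of_all _ fun x => Finset.sum_nonneg fun i _ => Finset.sum_nonneg fun i' _ => sq_nonneg _)
    (integrable_finsetSum _ fun i _ => integrable_finsetSum _ fun i' _ => hZint i i') t
  rw [le_div_iff₀ ht, mul_comm]
  refine hmark.trans ?_
  rw [integral_finsetSum _ fun i _ => integrable_finsetSum _ fun i' _ => hZint i i']
  calc ∑ i, ∫ x, ∑ i', Z i i' x ^ 2 ∂ρ = ∑ i, ∑ i', ∫ x, Z i i' x ^ 2 ∂ρ :=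
        Finset.sum_congr rfl fun i _ => integral_finsetSum _ fun i' _ => hZint i i'
    _ ≤ ∑ i : Fin m, ∑ i' : Fin m,
        (M / N + (k : ℝ) ^ 2 / N ^ 2 * (1 : Matrix (Fin m) (Fin m) ℝ) i i') :=
        Finset.sum_le_sum fun i _ => Finset.sum_le_sum fun i' _ => hZ2 i i'
    _ = _ := by
        simp only [Finset.sum_add_distrib, ← Finset.mul_sum, Matrix.one_apply,
          Finset.sum_ite_eq, Finset.mem_univ, if_true, Finset.sum_const, Finset.card_univ,
          Fintype.card_fin, nsmul_eq_mul]
        ring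

theorem integral_empPM {m k N : ℕ} (hm : 0 < m) (hk : 0 < k) (hmN : m ≤ N) (hkN : k ≤ N)
    (A : Matrix (Fin N) (Fin N) ℝ) (f : BoundedContinuousFunction ℝ ℝ) :
    ∫ x, f x ∂(empPM m k N A : Measure ℝ) = ((m : ℝ) * k)⁻¹ *
      ∑ q : Fin m × Fin k, f (√N * A (Fin.castLE hmN q.1) (Fin.castLE hkN q.2)) := by
  have hmk : ((m * k : ℕ) : ENNReal) ≠ 0 := by
    exact_mod_cast (Nat.mul_pos hm hk).ne'
  have hprob : IsProbabilityMeasure (empMeas m k N A) := by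
    constructor
    simp only [empMeas, Measure.smul_apply, Measure.finsetSum_apply, measure_univ,
      Finset.sum_const, Finset.card_range, nsmul_eq_mul, mul_one, smul_eq_mul]
    rw [← Nat.cast_mul]
    exact ENNReal.inv_mul_cancel hmk (ENNReal.natCast_ne_top _)
  have h0 : empPM m k N A = (⟨empMeas m k N A, hprob⟩ : ProbabilityMeasure ℝ) := dif_pos hprob
  have h1 : (empPM m k N A : Measure ℝ) = empMeas m k N A := by
    rw [h0]; rfl
  rw [h1, empMeas, integral_smul_measure, integral_finsetSum_measure]
  · have h2 : ∀ i ∈ Finset.range m, ∫ x, f x ∂(∑ j ∈ Finset.range k,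
        Measure.dirac (√N * entryOrZero A i j)) =
          ∑ j ∈ Finset.range k, f (√N * entryOrZero A i j) := fun i _ => by
      rw [integral_finsetSum_measure fun j _ => f.integrable _]
      exact Finset.sum_congr rfl fun j _ => integral_dirac _ _
    rw [Finset.sum_congr rfl h2, Finset.sum_range, Fintype.sum_prod_type]
    simp only [ENNReal.toReal_inv, Nat.cast_mul, smul_eq_mul]
    congr 1
    refine Finset.sum_congr rfl fun i _ => ?_
    rw [Finset.sum_range]
    refine Finset.sum_congr rfl fun j _ => ?_
    rw [entryOrZero, dif_pos ⟨i.2.trans_le hmN, j.2.trans_le hkN⟩]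
    rfl
  · intro i _
    exact f.integrable _

theorem empPM_transpose (m k N : ℕ) (A : Matrix (Fin N) (Fin N) ℝ) :
    empPM m k N Aᵀ = empPM k m N A := by
  have h : ∀ i j, entryOrZero Aᵀ i j = entryOrZero A j i := fun i j => by
    simp [entryOrZero, and_comm]
  have h1 : empMeas m k N Aᵀ = empMeas k m N A := by
    simp only [empMeas, h]
    rw [Finset.sum_comm, mul_comm]
  by_cases h2 : IsProbabilityMeasure (empMeas k m N A)
  · have h3 : IsProbabilityMeasure (empMeas m k N Aᵀ) := h1 ▸ h2
    exact (dif_pos h3).trans ((Subtype.ext h1).trans (dif_pos h2).symm)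
  · have h3 : ¬ IsProbabilityMeasure (empMeas m k N Aᵀ) := h1 ▸ h2
    have h4 : empPM m k N Aᵀ = (⟨Measure.dirac 0, inferInstance⟩ : ProbabilityMeasure ℝ) :=
      dif_neg h3
    have h5 : empPM k m N A = (⟨Measure.dirac 0, inferInstance⟩ : ProbabilityMeasure ℝ) :=
      dif_neg h2
    rw [h4, h5]

/-- With Gaussian probability at least `exp (-m k (H(ν|γ) + ε)) / 2`, the first `k` columns of an
`m × N` array look like a sample of `ν`, while the rows stay nearly orthonormal. -/
theorem exists_typical_set (ν : ProbabilityMeasure ℝ)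
    (hac : (ν : Measure ℝ) ≪ gaussianReal 0 1)
    (hintg : Integrable (llr (ν : Measure ℝ) (gaussianReal 0 1)) (ν : Measure ℝ))
    (F : Finset (BoundedContinuousFunction ℝ ℝ)) {ε e M δ : ℝ} (hε : 0 < ε) (he : 0 < e)
    (hM : ∫ x, x ^ 2 ∂(ν : Measure ℝ) < M) (hδ : 0 < δ) :
    ∃ (p₀ : ℕ) (c : ℝ), 0 < c ∧ c ≤ 1 ∧ ∀ (m k N : ℕ) (hkN : k ≤ N), 0 < m → m ≤ k →
      p₀ ≤ m * k → (m * k : ℝ) ≤ c * N → ∃ D : Set (Fin m × Fin N → ℝ), MeasurableSet D ∧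
        ENNReal.ofReal (Real.exp (-(m * k * ((∫ x, llr (ν : Measure ℝ) (gaussianReal 0 1) x
          ∂(ν : Measure ℝ)) + ε))) / 2) ≤ Measure.pi (fun _ => gaussianReal 0 1) D ∧
        ∀ x ∈ D, ∑ q : Fin m × Fin k, x (q.1, Fin.castLE hkN q.2) ^ 2 ≤ M * (m * k) ∧
          ∑ i, ∑ i', ((∑ l, x (i, l) * x (i', l)) / N - (1 : Matrix (Fin m) (Fin m) ℝ) i i') ^ 2
            ≤ δ ^ 2 ∧
          ∀ f ∈ F, |∑ q : Fin m × Fin k, f (x (q.1, Fin.castLE hkN q.2)) -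
            m * k * ∫ y, f y ∂(ν : Measure ℝ)| ≤ e * (m * k) := by
  classical
  set γ := gaussianReal 0 1 with hγ
  set h := ∫ x, llr (ν : Measure ℝ) γ x ∂(ν : Measure ℝ) with hh
  have hsq := integrable_sq_of_integrable_llr (ν : Measure ℝ) hac hintg
  have hM0 : 0 < M := (integral_nonneg fun x => sq_nonneg x).trans_lt hM
  set C4 := ∫ x, x ^ 4 ∂γ with hC4
  have hC40 : 0 ≤ C4 := integral_nonneg fun x => by positivity
  obtain ⟨p₁, -, hp₁⟩ := weak_law_of_integrable (ν : Measure ℝ) hsq (sub_pos.2 hM)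
    (show (0 : ℝ) < 1 / 8 by norm_num)
  obtain ⟨p₂, -, hp₂⟩ := weak_law_of_integrable (ν : Measure ℝ) hintg hε
    (show (0 : ℝ) < 1 / 8 by norm_num)
  have hη : (0 : ℝ) < 1 / (8 * (F.card + 1)) := by positivity
  have hF := fun f : BoundedContinuousFunction ℝ ℝ =>
    weak_law_of_integrable (ν : Measure ℝ) (f.integrable (ν : Measure ℝ)) he hη
  choose pF hpF0 hpF using hF
  refine ⟨p₁ + p₂ + ∑ f ∈ F, pF f, min 1 (min (δ / (2 * M)) (δ ^ 2 / (32 * (C4 + 1)))),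
    by positivity, min_le_left _ _, fun m k N hkN hm0 hmk hp hpN => ?_⟩
  set c := min 1 (min (δ / (2 * M)) (δ ^ 2 / (32 * (C4 + 1)))) with hc
  have hc0 : 0 < c := by positivity
  have hc1 : c ≤ 1 := min_le_left _ _
  have hc2 : c * M ≤ δ / 2 := by
    have : c ≤ δ / (2 * M) := (min_le_right _ _).trans (min_le_left _ _)
    rw [le_div_iff₀ (by positivity)] at this
    linarith
  have hc3 : (C4 + 1) * c ≤ δ ^ 2 / 32 := by
    have : c ≤ δ ^ 2 / (32 * (C4 + 1)) := (min_le_right _ _).trans (min_le_right _ _)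
    rw [le_div_iff₀ (by positivity)] at this
    linarith
  have hk0 : 0 < k := hm0.trans_le hmk
  have hN0 : 0 < N := hk0.trans_le hkN
  have hmR : (1 : ℝ) ≤ m := by exact_mod_cast hm0
  have hkR : (1 : ℝ) ≤ k := by exact_mod_cast hk0
  have hmkR : (m : ℝ) ≤ k := by exact_mod_cast hmk
  have hNR : (0 : ℝ) < N := by exact_mod_cast hN0
  set κ : Fin m × Fin N → Measure ℝ := fun p => if (p.2 : ℕ) < k then (ν : Measure ℝ) else γ
    with hκ
  have hκp : ∀ p, IsProbabilityMeasure (κ p) := fun p => by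
    simp only [hκ]; split_ifs <;> infer_instance
  have hκν : ∀ q : Fin m × Fin k, κ (q.1, Fin.castLE hkN q.2) = (ν : Measure ℝ) := fun q => by
    simp [hκ]
  have hκγ : ∀ p : Fin m × Fin N, k ≤ (p.2 : ℕ) → κ p = γ := fun p hp => by
    simp only [hκ]; rw [if_neg (by omega)]
  set ρ := Measure.pi κ with hρ
  set X : Fin m × Fin k → (Fin m × Fin N → ℝ) → ℝ := fun q x => x (q.1, Fin.castLE hkN q.2) with hX
  have hXm : ∀ q, Measurable (X q) := fun q => measurable_pi_apply _
  have hinj : Function.Injective fun q : Fin m × Fin k => (q.1, Fin.castLE hkN q.2) :=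
    fun a b hab => by
      obtain ⟨h1, h2⟩ := Prod.ext_iff.1 hab
      exact Prod.ext h1 (Fin.castLE_injective hkN h2)
  have hXind : iIndepFun X ρ :=
    (iIndepFun_pi (μ := κ) (X := fun _ => id) fun _ => aemeasurable_id).precomp hinj
  have hXlaw : ∀ q ∈ (Finset.univ : Finset (Fin m × Fin k)), ρ.map (X q) = (ν : Measure ℝ) :=
    fun q _ => by
      rw [← hκν q]; exact (measurePreserving_eval κ _).map_eq
  have hcard : (Finset.univ : Finset (Fin m × Fin k)).card = m * k := by simp
  have hw₁ := hp₁ ρ Finset.univ X hXind hXm hXlaw (by rw [hcard]; omega)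
  have hw₂ := hp₂ ρ Finset.univ X hXind hXm hXlaw (by rw [hcard]; omega)
  have hwF : ∀ f ∈ F, _ := fun f hf => hpF f ρ Finset.univ X hXind hXm hXlaw (by
    have := Finset.single_le_sum (f := pF) (fun _ _ => Nat.zero_le _) hf
    rw [hcard]; omega)
  simp only [hcard, Nat.cast_mul] at hw₁ hw₂ hwF
  have hg := measureReal_gram_sub_one_le (m := m) hN0 hkN κ hκγ
    (show 0 < δ ^ 2 / 4 by positivity)
  set B₁ := {ω | (M - ∫ x, x ^ 2 ∂(ν : Measure ℝ)) * ((m : ℝ) * k) ≤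
    |∑ q, X q ω ^ 2 - m * k * ∫ x, x ^ 2 ∂(ν : Measure ℝ)|} with hB₁
  set B₂ := {ω | ε * ((m : ℝ) * k) ≤ |∑ q, llr (ν : Measure ℝ) γ (X q ω) - m * k * h|} with hB₂
  set BF : BoundedContinuousFunction ℝ ℝ → Set (Fin m × Fin N → ℝ) := fun f =>
    {ω | e * ((m : ℝ) * k) ≤ |∑ q, f (X q ω) - m * k * ∫ x, f x ∂(ν : Measure ℝ)|} with hBF
  set B₃ := {x : Fin m × Fin N → ℝ | δ ^ 2 / 4 ≤ ∑ i, ∑ i',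
    ((∑ l ∈ {l : Fin N | k ≤ (l : ℕ)}, x (i, l) * x (i', l)) / N -
      (1 : Matrix (Fin m) (Fin m) ℝ) i i') ^ 2} with hB₃
  have hmB₁ : MeasurableSet B₁ := measurableSet_le measurable_const (by fun_prop)
  have hmB₂ : MeasurableSet B₂ := by
    have := measurable_llr (ν : Measure ℝ) γ
    exact measurableSet_le measurable_const (by fun_prop)
  have hmB₃ : MeasurableSet B₃ := measurableSet_le measurable_const (by fun_prop)
  have hmBF : ∀ f, MeasurableSet (BF f) := fun f => by
    have : Measurable f := f.continuous.measurable
    exact measurableSet_le measurable_const (by fun_prop)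
  have hw₃ : ρ.real B₃ ≤ 1 / 8 := by
    refine hg.trans ?_
    rw [div_le_iff₀ (by positivity)]
    have h1 : C4 * m ^ 2 / N ≤ C4 * c := by
      rw [div_le_iff₀ hNR, mul_assoc]
      gcongr
      nlinarith
    have h2 : (m : ℝ) * k ^ 2 / N ^ 2 ≤ c := by
      rw [div_le_iff₀ (by positivity)]
      have h3 : (m : ℝ) * k ^ 2 ≤ (m * k) * (m * k) := by
        nlinarith [mul_pos (zero_lt_one.trans_le hmR) (pow_pos (zero_lt_one.trans_le hkR) 2)]
      have h4 : (m * k : ℝ) ≤ N := hpN.trans (by nlinarith)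
      calc (m : ℝ) * k ^ 2 ≤ (m * k) * (m * k) := h3
        _ ≤ (c * N) * N := by gcongr
        _ = c * N ^ 2 := by ring
    linarith
  have hwF' : ρ.real (⋃ f ∈ F, BF f) ≤ 1 / 8 := by
    refine (measureReal_biUnion_finset_le _ _).trans ((Finset.sum_le_card_nsmul _ _ _ hwF).trans ?_)
    rw [nsmul_eq_mul, mul_one_div, div_le_div_iff₀ (by positivity) (by norm_num)]
    linarith
  set B := B₁ ∪ B₂ ∪ B₃ ∪ ⋃ f ∈ F, BF f with hB
  have hmB : MeasurableSet B := ((hmB₁.union hmB₂).union hmB₃).union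
    (Finset.measurableSet_biUnion _ fun f _ => hmBF f)
  have hρB : ρ.real B ≤ 1 / 2 := by
    have h1 := measureReal_union_le (μ := ρ) (B₁ ∪ B₂ ∪ B₃) (⋃ f ∈ F, BF f)
    have h2 := measureReal_union_le (μ := ρ) (B₁ ∪ B₂) B₃
    have h3 := measureReal_union_le (μ := ρ) B₁ B₂
    linarith
  have hmem : ∀ x ∈ Bᶜ, x ∉ B₁ ∧ x ∉ B₂ ∧ x ∉ B₃ ∧ ∀ f ∈ F, x ∉ BF f := fun x hx => by
    simp only [hB, Set.mem_compl_iff, Set.mem_union, Set.mem_iUnion, not_or, not_exists] at hx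
    exact ⟨hx.1.1.1, hx.1.1.2, hx.1.2, hx.2⟩
  refine ⟨Bᶜ, hmB.compl, ?_, fun x hx => ?_⟩
  · have hκac : ∀ p, κ p ≪ γ := fun p => by
      simp only [hκ]; split_ifs
      · exact hac
      · exact Measure.AbsolutelyContinuous.rfl
    have hae : ∀ᵐ x ∂(Measure.pi fun _ : Fin m × Fin N => γ), ∀ p : Fin m × Fin N,
        k ≤ (p.2 : ℕ) → llr (κ p) γ (x p) = 0 := by
      rw [ae_all_iff]
      intro p
      by_cases hp : k ≤ (p.2 : ℕ)
      · rw [hκγ p hp]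
        filter_upwards [(measurePreserving_eval (fun _ : Fin m × Fin N => γ)
          p).quasiMeasurePreserving.ae (llr_self γ)] with x hx _ using hx
      · exact ae_of_all _ fun x h => absurd h hp
    have hle := pi_le_exp_mul_of_sum_llr_le κ (fun _ => γ) hκac hmB.compl
      (t := m * k * (h + ε)) (by
        filter_upwards [hae] with x hx hxB
        have h2 := (hmem x hxB).2.1
        simp only [hB₂, Set.mem_ofPred_eq, not_le] at h2
        have h3 : ∑ p, llr (κ p) γ (x p) = ∑ q, llr (ν : Measure ℝ) γ (X q x) := by
          rw [Fintype.sum_prod_type, Fintype.sum_prod_type]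
          refine Finset.sum_congr rfl fun i _ => ?_
          rw [Fin.sum_eq_sum_castLE_add hkN, Finset.sum_eq_zero (s := Finset.univ.filter _)
            fun l hl => hx (i, l) (by simpa using hl), add_zero]
          exact Finset.sum_congr rfl fun j _ => by rw [hκν (i, j)]
        rw [h3]
        linarith [(abs_lt.1 h2).2])
    have h1 : (1 / 2 : ℝ) ≤ ρ.real Bᶜ := by
      rw [probReal_compl_eq_one_sub hmB]; linarith
    have h2 : ENNReal.ofReal (1 / 2) ≤ ρ Bᶜ := by
      rw [← ofReal_measureReal]; exact ENNReal.ofReal_le_ofReal h1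
    calc ENNReal.ofReal (Real.exp (-(m * k * (h + ε))) / 2)
        = ENNReal.ofReal (Real.exp (-(m * k * (h + ε)))) * ENNReal.ofReal (1 / 2) := by
          rw [← ENNReal.ofReal_mul (Real.exp_pos _).le, mul_one_div]
      _ ≤ ENNReal.ofReal (Real.exp (-(m * k * (h + ε)))) *
          (ENNReal.ofReal (Real.exp (m * k * (h + ε))) * Measure.pi (fun _ => γ) Bᶜ) := by
          gcongr; exact h2.trans hle
      _ = Measure.pi (fun _ => γ) Bᶜ := by
          rw [← mul_assoc, ← ENNReal.ofReal_mul (Real.exp_pos _).le, ← Real.exp_add]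
          simp
  · obtain ⟨h1, -, h3, h4⟩ := hmem x hx
    simp only [hB₁, hB₃, hBF, Set.mem_ofPred_eq, not_le] at h1 h3 h4
    have hblock : ∑ q, X q x ^ 2 ≤ M * (m * k) := by linarith [(abs_lt.1 h1).2]
    refine ⟨hblock, ?_, fun f hf => (h4 f hf).le⟩
    set a : Fin m → Fin m → ℝ := fun i i' =>
      (∑ j : Fin k, X (i, j) x * X (i', j) x) / N with ha
    set b : Fin m → Fin m → ℝ := fun i i' =>
      (∑ l ∈ {l : Fin N | k ≤ (l : ℕ)}, x (i, l) * x (i', l)) / N -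
        (1 : Matrix (Fin m) (Fin m) ℝ) i i' with hb
    have hab : ∀ i i', (∑ l, x (i, l) * x (i', l)) / N - (1 : Matrix (Fin m) (Fin m) ℝ) i i' =
        a i i' + b i i' := fun i i' => by
      rw [Fin.sum_eq_sum_castLE_add hkN]
      simp only [ha, hb, hX]
      ring
    set S : Fin m → ℝ := fun i => ∑ j : Fin k, X (i, j) x ^ 2 with hS
    have hSsum : ∑ i, S i = ∑ q, X q x ^ 2 := (Fintype.sum_prod_type fun q => X q x ^ 2).symm
    have ha2 : ∀ i i', a i i' ^ 2 ≤ S i * S i' / N ^ 2 := fun i i' => by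
      rw [ha, div_pow]
      gcongr
      exact Finset.sum_mul_sq_le_sq_mul_sq _ _ _
    have hasum : ∑ i, ∑ i', a i i' ^ 2 ≤ δ ^ 2 / 4 := by
      calc ∑ i, ∑ i', a i i' ^ 2 ≤ ∑ i, ∑ i', S i * S i' / N ^ 2 :=
            Finset.sum_le_sum fun i _ => Finset.sum_le_sum fun i' _ => ha2 i i'
        _ = ((∑ i, S i) / N) ^ 2 := by
            simp_rw [← Finset.sum_div, ← Finset.mul_sum, ← Finset.sum_mul]
            ring
        _ ≤ (δ / 2) ^ 2 := by
            have h5 : 0 ≤ ∑ i, S i := Finset.sum_nonneg fun i _ =>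
              Finset.sum_nonneg fun j _ => sq_nonneg _
            refine pow_le_pow_left₀ (by positivity) ?_ 2
            rw [div_le_iff₀ hNR, hSsum]
            calc ∑ q, X q x ^ 2 ≤ M * (m * k) := hblock
              _ ≤ M * (c * N) := by gcongr
              _ = (c * M) * N := by ring
              _ ≤ δ / 2 * N := by gcongr
        _ = δ ^ 2 / 4 := by ring
    simp_rw [hab]
    calc ∑ i, ∑ i', (a i i' + b i i') ^ 2 ≤ ∑ i, ∑ i', 2 * (a i i' ^ 2 + b i i' ^ 2) :=
          Finset.sum_le_sum fun i _ => Finset.sum_le_sum fun i' _ => add_sq_le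
      _ = 2 * ∑ i, ∑ i', a i i' ^ 2 + 2 * ∑ i, ∑ i', b i i' ^ 2 := by
          simp_rw [← Finset.mul_sum, Finset.sum_add_distrib, mul_add]
      _ ≤ δ ^ 2 := by linarith

/-- Lower bound for the probability that the empirical measure lies in a neighbourhood of `ν`,
uniform over block sizes `m ≤ k` with `m * k` large and `m * k / N` small. -/
theorem exists_le_measure_empPM_mem_of_le (ν : ProbabilityMeasure ℝ)
    (hac : (ν : Measure ℝ) ≪ gaussianReal 0 1)
    (hintg : Integrable (llr (ν : Measure ℝ) (gaussianReal 0 1)) (ν : Measure ℝ))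
    {O : Set (ProbabilityMeasure ℝ)} (hO : O ∈ nhds ν) {ε : ℝ} (hε : 0 < ε) :
    ∃ (p₀ : ℕ) (c : ℝ), 0 < c ∧ ∀ (m k N : ℕ), 0 < m → m ≤ k → p₀ ≤ m * k →
      (m * k : ℝ) ≤ c * N → ∀ (μ : Measure (Matrix (Fin N) (Fin N) ℝ)) [IsProbabilityMeasure μ],
      μ {A | A * Aᵀ = 1} = 1 →
      (∀ B : Matrix (Fin N) (Fin N) ℝ, B * Bᵀ = 1 → μ.map (fun A => B * A) = μ) →
        ENNReal.ofReal (Real.exp (-(m * k * ((∫ x, llr (ν : Measure ℝ) (gaussianReal 0 1) x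
          ∂(ν : Measure ℝ)) + ε))) / 2) ≤ μ {A | empPM m k N A ∈ O} := by
  obtain ⟨F, ε₁, hε₁, hFO⟩ := exists_finite_integral_basis_of_mem_nhds ν hO
  have hM2 : 0 ≤ ∫ x, x ^ 2 ∂(ν : Measure ℝ) := integral_nonneg fun x => sq_nonneg x
  set M := 1 + ∫ x, x ^ 2 ∂(ν : Measure ℝ) with hM
  have hM0 : 0 < M := by linarith
  have he : 0 < ε₁ / (4 * (1 + M)) := by positivity
  choose Cf hCf0 hCf using fun f : BoundedContinuousFunction ℝ ℝ =>
    BoundedContinuousFunction.exists_abs_sub_le_sq f he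
  set e := ε₁ / (4 * (1 + M)) with he'
  set C := ∑ f ∈ F, Cf f with hC
  have hC0 : 0 ≤ C := Finset.sum_nonneg fun f _ => hCf0 f
  have hCle : ∀ f ∈ F, Cf f ≤ C := fun f hf =>
    Finset.single_le_sum (fun f _ => hCf0 f) hf
  set δ := min (1 / 2) (ε₁ / (16 * C * M + 1)) with hδ
  have hδ0 : 0 < δ := by positivity
  have hδ1 : δ ≤ 1 / 2 := min_le_left _ _
  have hδ2 : C * (4 * δ ^ 2 * M) < ε₁ / 4 := by
    have h1 : δ ≤ ε₁ / (16 * C * M + 1) := min_le_right _ _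
    rw [le_div_iff₀ (by positivity)] at h1
    have h2 : C * M * δ ^ 2 ≤ C * M * δ := by
      gcongr
      nlinarith
    nlinarith
  obtain ⟨p₀, c, hc0, hc1, hD⟩ := exists_typical_set ν hac hintg F hε
    (show 0 < ε₁ / 2 / 2 by positivity) (show ∫ x, x ^ 2 ∂(ν : Measure ℝ) < M by linarith) hδ0
  refine ⟨p₀, c, hc0, fun m k N hm0 hmk hp hpN μ _ hsupp hinv => ?_⟩
  have hk0 : 0 < k := hm0.trans_le hmk
  have hpN' : m * k ≤ N := by
    have h1 : (m * k : ℝ) ≤ N := hpN.trans (by nlinarith [(Nat.cast_nonneg N : (0 : ℝ) ≤ N)])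
    exact_mod_cast h1
  have hkN : k ≤ N := (Nat.le_mul_of_pos_left k hm0).trans hpN'
  have hmN : m ≤ N := hmk.trans hkN
  obtain ⟨D, hDm, hDle, hDx⟩ := hD m k N hkN hm0 hmk hp hpN
  refine hDle.trans (pi_gaussianReal_le_of_forall_near hmN (hk0.trans_le hkN) μ hsupp hinv hδ0.le
    hδ1 hDm (fun x hx => (hDx x hx).2.1) fun x hx A hA => hFO _ fun f hf => ?_)
  obtain ⟨hx1, -, hx3⟩ := hDx x hx
  rw [integral_empPM hm0 hk0 hmN hkN]
  have hp0 : (0 : ℝ) < m * k := by positivity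
  set p : ℝ := m * k with hp'
  set y : Fin m × Fin k → ℝ := fun q => √N * A (Fin.castLE hmN q.1) (Fin.castLE hkN q.2) with hy
  set z : Fin m × Fin k → ℝ := fun q => x (q.1, Fin.castLE hkN q.2) with hz
  have hdist : ∑ q, (y q - z q) ^ 2 ≤ 4 * δ ^ 2 * ∑ q, z q ^ 2 := by
    rw [Fintype.sum_prod_type_right, Fintype.sum_prod_type_right, Finset.mul_sum]
    exact Finset.sum_le_sum fun j _ => hA (Fin.castLE hkN j)
  have hcardp : ((Finset.univ : Finset (Fin m × Fin k)).card : ℝ) = p := by simp [hp']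
  have h1 : |∑ q, f (y q) - ∑ q, f (z q)| ≤ e * (p + M * p) + C * (4 * δ ^ 2 * (M * p)) := by
    rw [← Finset.sum_sub_distrib]
    calc |∑ q, (f (y q) - f (z q))| ≤ ∑ q, |f (y q) - f (z q)| := Finset.abs_sum_le_sum_abs _ _
      _ ≤ ∑ q, (e + e * z q ^ 2 + C * (y q - z q) ^ 2) := by
          refine Finset.sum_le_sum fun q _ => ?_
          rw [abs_sub_comm]
          refine (hCf f (z q) (y q)).trans ?_
          rw [← neg_sub (y q) (z q), neg_sq]
          gcongr
          exact hCle f hf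
      _ = e * (p + ∑ q, z q ^ 2) + C * ∑ q, (y q - z q) ^ 2 := by
          rw [Finset.sum_add_distrib, Finset.sum_add_distrib, Finset.sum_const, nsmul_eq_mul,
            hcardp, ← Finset.mul_sum, ← Finset.mul_sum]
          ring
      _ ≤ _ := by
          have := hdist.trans (mul_le_mul_of_nonneg_left hx1 (by positivity))
          gcongr
  have h2 := hx3 f hf
  have h3 : e * (1 + M) = ε₁ / 4 := by rw [he']; field_simp
  have h4 : |∑ q, f (y q) - p * ∫ u, f u ∂(ν : Measure ℝ)| < ε₁ * p := by
    have h5 := abs_sub_le (∑ q, f (y q)) (∑ q, f (z q)) (p * ∫ u, f u ∂(ν : Measure ℝ))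
    nlinarith [mul_lt_mul_of_pos_right hδ2 hp0]
  have h6 : p⁻¹ * ∑ q, f (y q) - ∫ u, f u ∂(ν : Measure ℝ) =
      (∑ q, f (y q) - p * ∫ u, f u ∂(ν : Measure ℝ)) / p := by field_simp
  rw [h6, abs_div, abs_of_pos hp0, div_lt_iff₀ hp0]
  exact h4

/-- The version of `exists_le_measure_empPM_mem_of_le` without the assumption `m ≤ k`. -/
theorem exists_le_measure_empPM_mem (ν : ProbabilityMeasure ℝ)
    (hac : (ν : Measure ℝ) ≪ gaussianReal 0 1)
    (hintg : Integrable (llr (ν : Measure ℝ) (gaussianReal 0 1)) (ν : Measure ℝ))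
    {O : Set (ProbabilityMeasure ℝ)} (hO : O ∈ nhds ν) {ε : ℝ} (hε : 0 < ε) :
    ∃ (p₀ : ℕ) (c : ℝ), 0 < c ∧ ∀ (m k N : ℕ), 0 < m * k → p₀ ≤ m * k →
      (m * k : ℝ) ≤ c * N → ∀ (μ : Measure (Matrix (Fin N) (Fin N) ℝ)) [IsProbabilityMeasure μ],
      μ {A | A * Aᵀ = 1} = 1 →
      (∀ B : Matrix (Fin N) (Fin N) ℝ, B * Bᵀ = 1 → μ.map (fun A => B * A) = μ) →
        ENNReal.ofReal (Real.exp (-(m * k * ((∫ x, llr (ν : Measure ℝ) (gaussianReal 0 1) x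
          ∂(ν : Measure ℝ)) + ε))) / 2) ≤ μ {A | empPM m k N A ∈ O} := by
  obtain ⟨p₀, c, hc, h⟩ := exists_le_measure_empPM_mem_of_le ν hac hintg hO hε
  refine ⟨p₀, c, hc, fun m k N hmk0 hp hpN μ _ hsupp hinv => ?_⟩
  rcases le_total m k with hmk | hmk
  · exact h m k N (Nat.pos_of_mul_pos_right hmk0) hmk hp hpN μ hsupp hinv
  · refine ((mul_comm (m : ℝ) k) ▸ h k m N (Nat.pos_of_mul_pos_left hmk0) hmk
      (mul_comm m k ▸ hp) (mul_comm (m : ℝ) k ▸ hpN) μ hsupp hinv).trans ?_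
    have h1 : {A | empPM k m N A ∈ O} = (fun A => Aᵀ) ⁻¹' {A | empPM m k N A ∈ O} := by
      ext A
      simp only [Set.mem_preimage, Set.mem_ofPred_eq, empPM_transpose]
    rw [h1]
    refine (Measure.le_map_apply measurable_matrix_transpose.aemeasurable _).trans_eq ?_
    rw [measure_transpose_mem_eq μ hsupp hinv]

/-- **LDP lower bound for the empirical measure of scaled entries of a Haar orthogonal
matrix.** Here `μ N` is the Haar probability measure on `O(N)`, viewed as a measure on
`N × N` matrices: it is a probability measure, concentrated on orthogonal matrices, and
invariant under left multiplication by orthogonal matrices. -/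
theorem stmt_1
    (m k : ℕ → ℕ)
    (hp_top : Tendsto (fun N => m N * k N) atTop atTop)
    (hp_o : (fun N => (m N * k N : ℝ)) =o[atTop] fun N => (N : ℝ))
    (μ : (N : ℕ) → Measure (Matrix (Fin N) (Fin N) ℝ))
    (hμ_prob : ∀ N, IsProbabilityMeasure (μ N))
    (hμ_supp : ∀ N, μ N {A | A * Aᵀ = 1} = 1)
    (hμ_inv : ∀ N (B : Matrix (Fin N) (Fin N) ℝ), B * Bᵀ = 1 →
      (μ N).map (fun A => B * A) = μ N)
    (O : Set (ProbabilityMeasure ℝ)) (hO : IsOpen O) :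
    - ⨅ ν ∈ O, relEntropy (ν : Measure ℝ) (gaussianReal 0 1)
      ≤ Filter.liminf
          (fun N => (((m N * k N : ℝ))⁻¹ : EReal) *
            ENNReal.log (μ N {A | empPM (m N) (k N) N A ∈ O})) atTop := by
  rw [EReal.neg_le]
  refine le_iInf₂ fun ν hν => ?_
  rw [EReal.neg_le]
  by_cases hfin : (ν : Measure ℝ) ≪ gaussianReal 0 1 ∧
      Integrable (llr (ν : Measure ℝ) (gaussianReal 0 1)) (ν : Measure ℝ)
  swap
  · rw [relEntropy, if_neg hfin, EReal.neg_top]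
    exact bot_le
  rw [relEntropy, if_pos hfin]
  set h := ∫ x, llr (ν : Measure ℝ) (gaussianReal 0 1) x ∂(ν : Measure ℝ) with hh
  have key : ∀ ε : ℝ, 0 < ε → ((-h - 2 * ε : ℝ) : EReal) ≤ liminf
      (fun N => (((m N * k N : ℝ))⁻¹ : EReal) *
        ENNReal.log (μ N {A | empPM (m N) (k N) N A ∈ O})) atTop := by
    intro ε hε
    obtain ⟨p₀, c, hc, hb⟩ := exists_le_measure_empPM_mem ν hfin.1 hfin.2 (hO.mem_nhds hν) hε
    refine le_liminf_of_le (by isBoundedDefault) ?_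
    filter_upwards [hp_top.eventually_ge_atTop (p₀ + 1 + ⌈Real.log 2 / ε⌉₊),
      hp_o.def hc] with N hN1 hN2
    have := hμ_prob N
    have hpos : (0 : ℝ) < m N * k N := by
      have : 0 < m N * k N := by omega
      exact_mod_cast this
    rw [Real.norm_of_nonneg hpos.le, Real.norm_of_nonneg (Nat.cast_nonneg N)] at hN2
    have hlow := hb (m N) (k N) N (by omega) (by omega) hN2 (μ N) (hμ_supp N) (hμ_inv N)
    have hlog := ENNReal.log_monotone hlow
    rw [ENNReal.log_ofReal_of_pos (by positivity), Real.log_div (Real.exp_pos _).ne' two_ne_zero,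
      Real.log_exp] at hlog
    have h2 : Real.log 2 ≤ ε * (m N * k N) := by
      have h3 : (⌈Real.log 2 / ε⌉₊ : ℝ) ≤ m N * k N := by
        have : ⌈Real.log 2 / ε⌉₊ ≤ m N * k N := by omega
        exact_mod_cast this
      have h4 := (Nat.le_ceil (Real.log 2 / ε)).trans h3
      rw [div_le_iff₀ hε] at h4
      linarith
    have h5 : -h - 2 * ε ≤ ((m N : ℝ) * k N)⁻¹ *
        (-(m N * k N * (h + ε)) - Real.log 2) := by
      rw [inv_mul_eq_div, le_div_iff₀ hpos]
      linarith
    refine (EReal.coe_le_coe_iff.2 h5).trans ?_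
    rw [EReal.coe_mul]
    refine le_trans (mul_le_mul_of_nonneg_left hlog
      (EReal.coe_nonneg.2 (inv_pos.2 hpos).le)) (le_of_eq ?_)
    congr 1
  rw [← EReal.coe_neg]
  refine EReal.ge_of_forall_gt_iff_ge.1 fun z hz => ?_
  have hz' : z < -h := EReal.coe_lt_coe_iff.1 hz
  have := key ((-h - z) / 2) (by linarith)
  rwa [show -h - 2 * ((-h - z) / 2) = z by ring] at this
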